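/- arXiv:1912.12921 — 2 statements merged into one kernel-verified Lean document; each statement's English description precedes it below -/
import Mathlib

section
/- For m ≥ 2 and n ≥ 1, the nonzero eigenvalues of the complete m-uniform m-partite hypergraph K^m_{n,n,…,n} (m parts, each of size n) are n^{m−1} with multiplicity 1 and −n^{m−1}/(m−1) with multiplicity m−1; equivalently, the characteristic polynomial of its adjacency matrix is x^{nm−m}·(x − n^{m−1})·(x + n^{m−1}/(m−1))^{m−1}. -/
open scoped BigOperators
open Polynomial

/-- The edge set of the complete `m`-uniform `m`-partite hypergraph with parts
`V_p = {p} × Fin (nn p)`: all `m`-element subsets containing exactly one vertex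
from each part. -/
def KEdges (m : ℕ) (nn : Fin m → ℕ) : Finset (Finset (Σ p : Fin m, Fin (nn p))) :=
  Finset.univ.filter
    (fun f => f.card = m ∧ ∀ p : Fin m, (f.filter (fun x => x.1 = p)).card = 1)

/-- The adjacency matrix: `A i j = d_{ij} / (m - 1)` for `i ≠ j`, where `d_{ij}`
is the number of edges containing both `i` and `j`, and `A i i = 0`. -/
noncomputable def KAdj (m : ℕ) (nn : Fin m → ℕ) :
    Matrix (Σ p : Fin m, Fin (nn p)) (Σ p : Fin m, Fin (nn p)) ℝ :=
  fun i j => if i = j then 0 else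
    (((KEdges m nn).filter (fun f => i ∈ f ∧ j ∈ f)).card : ℝ) / ((m : ℝ) - 1)

/-- The edge of the complete multipartite hypergraph that selects `g p` from the part `p`. -/
def transversal {m : ℕ} {nn : Fin m → ℕ} (g : ∀ p, Fin (nn p)) :
    Finset (Σ p : Fin m, Fin (nn p)) :=
  Finset.univ.filter (fun x => g x.1 = x.2)

theorem mem_transversal {m : ℕ} {nn : Fin m → ℕ} (g : ∀ p, Fin (nn p))
    (x : Σ p : Fin m, Fin (nn p)) : x ∈ transversal g ↔ g x.1 = x.2 := by
  simp [transversal]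

theorem transversal_injective {m : ℕ} {nn : Fin m → ℕ} :
    Function.Injective (transversal (m := m) (nn := nn)) := by
  intro g h hgh
  funext p
  have h1 := (mem_transversal g ⟨p, g p⟩).2 rfl
  rw [hgh, mem_transversal] at h1
  exact h1.symm

theorem transversal_mem_KEdges {m : ℕ} {nn : Fin m → ℕ} (g : ∀ p, Fin (nn p)) :
    transversal g ∈ KEdges m nn := by
  have hfib : ∀ p : Fin m, ((transversal g).filter (fun x => x.1 = p)).card = 1 := by
    intro p
    rw [Finset.card_eq_one]
    refine ⟨⟨p, g p⟩, ?_⟩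
    ext ⟨q, a⟩
    simp only [Finset.mem_filter, mem_transversal, Finset.mem_singleton]
    constructor
    · rintro ⟨rfl, rfl⟩
      rfl
    · intro h
      cases h
      exact ⟨rfl, rfl⟩
  simp only [KEdges, Finset.mem_filter, Finset.mem_univ, true_and]
  refine ⟨?_, hfib⟩
  rw [Finset.card_eq_sum_card_fiberwise (f := fun x => x.1) (t := Finset.univ) (by simp)]
  simp [hfib]

theorem exists_transversal_eq {m : ℕ} {nn : Fin m → ℕ} {f : Finset (Σ p : Fin m, Fin (nn p))}
    (hf : f ∈ KEdges m nn) : ∃ g : ∀ p, Fin (nn p), transversal g = f := by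
  simp only [KEdges, Finset.mem_filter, Finset.mem_univ, true_and] at hf
  have hfib : ∀ p, ∃ a : Fin (nn p), ∀ b, (⟨p, b⟩ : Σ p : Fin m, Fin (nn p)) ∈ f ↔ a = b := by
    intro p
    obtain ⟨⟨q, a⟩, hx⟩ := Finset.card_eq_one.1 (hf.2 p)
    have hq : (⟨q, a⟩ : Σ p : Fin m, Fin (nn p)) ∈ f.filter (fun x => x.1 = p) := by simp [hx]
    obtain rfl : q = p := (Finset.mem_filter.1 hq).2
    refine ⟨a, fun b => ?_⟩
    have h := Finset.ext_iff.1 hx ⟨q, b⟩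
    simp only [Finset.mem_filter, Finset.mem_singleton, and_true] at h
    rw [h]
    simp [eq_comm]
  choose g hg using hfib
  refine ⟨g, ?_⟩
  ext ⟨p, b⟩
  rw [mem_transversal, hg]

theorem card_KEdges_filter {m : ℕ} {nn : Fin m → ℕ} (i j : Σ p : Fin m, Fin (nn p)) :
    ((KEdges m nn).filter (fun f => i ∈ f ∧ j ∈ f)).card =
      (Finset.univ.filter
        (fun g : ∀ p, Fin (nn p) => g i.1 = i.2 ∧ g j.1 = j.2)).card := by
  symm
  refine Finset.card_bij (fun g _ => transversal g) ?_ (fun _ _ _ _ h => transversal_injective h) ?_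
  · intro g hg
    simpa [mem_transversal, transversal_mem_KEdges] using hg
  · intro f hf
    obtain ⟨hf, hij⟩ := Finset.mem_filter.1 hf
    obtain ⟨g, rfl⟩ := exists_transversal_eq hf
    exact ⟨g, by simpa [mem_transversal] using hij, rfl⟩

theorem card_filter_apply_eq_and_apply_eq {ι α : Type*} [Fintype ι] [DecidableEq ι] [Fintype α]
    [DecidableEq α] {p q : ι} (hpq : p ≠ q) (a b : α) :
    (Finset.univ.filter (fun g : ι → α => g p = a ∧ g q = b)).card =
      Fintype.card α ^ (Fintype.card ι - 2) := by
  have hset : Finset.univ.filter (fun g : ι → α => g p = a ∧ g q = b) =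
      Fintype.piFinset (fun r => if r = p then {a} else if r = q then {b} else Finset.univ) := by
    ext g
    simp only [Finset.mem_filter, Finset.mem_univ, true_and, Fintype.mem_piFinset]
    constructor
    · rintro ⟨rfl, rfl⟩ r
      split_ifs <;> simp_all
    · intro h
      exact ⟨by simpa using h p, by simpa [hpq.symm] using h q⟩
  have hcard : ∀ r, (if r = p then {a} else if r = q then {b} else Finset.univ : Finset α).card =
      if r ∈ ({p, q} : Finset ι) then 1 else Fintype.card α := by
    intro r
    by_cases h1 : r = p
    · simp [h1]
    · by_cases h2 : r = q
      · subst h2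
        simp [h1]
      · simp [h1, h2, Finset.card_univ]
  rw [hset, Fintype.card_piFinset, Finset.prod_congr rfl (fun r _ => hcard r), Finset.prod_ite]
  have hcompl : Finset.univ.filter (fun r => r ∉ ({p, q} : Finset ι)) = ({p, q} : Finset ι)ᶜ := by
    ext; simp
  rw [hcompl, Finset.prod_const, Finset.prod_const, one_pow, one_mul, Finset.card_compl,
    Finset.card_pair hpq]

theorem KAdj_const_apply (m n : ℕ) (i j : Σ _ : Fin m, Fin n) :
    KAdj m (fun _ => n) i j =
      if i.1 = j.1 then 0 else (n : ℝ) ^ (m - 2) / ((m : ℝ) - 1) := by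
  rw [KAdj]
  by_cases h1 : i.1 = j.1
  · obtain ⟨p, a⟩ := i
    obtain ⟨q, b⟩ := j
    obtain rfl : p = q := h1
    by_cases hab : a = b
    · simp [hab]
    · rw [card_KEdges_filter, Finset.filter_eq_empty_iff.2]
      · simp
      · rintro g - ⟨ha, hb⟩
        exact hab (ha.symm.trans hb)
  · rw [if_neg h1, if_neg (fun h => h1 (congrArg Sigma.fst h)), card_KEdges_filter,
      card_filter_apply_eq_and_apply_eq h1]
    simp

/-- The vertex-by-part incidence matrix of `m` parts of size `n`. -/
def partIncidence (m n : ℕ) : Matrix (Σ _ : Fin m, Fin n) (Fin m) ℝ :=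
  Matrix.of fun i p => if i.1 = p then 1 else 0

theorem KAdj_const_eq_mul (m n : ℕ) :
    KAdj m (fun _ => n) = partIncidence m n * Matrix.of (fun p (j : Σ _ : Fin m, Fin n) =>
      if p = j.1 then 0 else (n : ℝ) ^ (m - 2) / ((m : ℝ) - 1)) := by
  ext i j
  rw [KAdj_const_apply, Matrix.mul_apply]
  simp only [partIncidence, Matrix.of_apply, ite_mul, one_mul, zero_mul, Finset.sum_ite_eq,
    Finset.mem_univ, if_true]

theorem mul_partIncidence (m n : ℕ) (c : ℝ) :
    Matrix.of (fun p (j : Σ _ : Fin m, Fin n) => if p = j.1 then 0 else c) * partIncidence m n =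
      Matrix.vecMulVec (fun _ => (n : ℝ) * c) (fun _ => 1) - Matrix.scalar (Fin m) (n * c) := by
  ext p q
  rw [Matrix.mul_apply, Fintype.sum_sigma]
  by_cases h : p = q
  · simp [partIncidence, Matrix.vecMulVec_apply, h]
  · simp [partIncidence, Matrix.vecMulVec_apply, h]

/-- the nonzero eigenvalues of `K^m_{n,n,…,n}` are `n^(m-1)` with
multiplicity `1` and `-n^(m-1)/(m-1)` with multiplicity `m-1`; equivalently the
characteristic polynomial is `x^(nm-m) (x - n^(m-1)) (x + n^(m-1)/(m-1))^(m-1)`. -/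
theorem stmt_5 (m n : ℕ) (hm : 2 ≤ m) (hn : 1 ≤ n) :
    (KAdj m (fun _ => n)).charpoly
      = X ^ (n * m - m) * (X - C ((n : ℝ) ^ (m - 1))) *
          (X + C ((n : ℝ) ^ (m - 1) / ((m : ℝ) - 1))) ^ (m - 1) := by
  obtain ⟨k, rfl⟩ := Nat.exists_eq_add_of_le' hm
  have hk : ((k + 2 : ℕ) : ℝ) - 1 ≠ 0 := by
    rw [sub_ne_zero]
    norm_cast
    omega
  have hc : (n : ℝ) * (n ^ (k + 2 - 2) / (((k + 2 : ℕ) : ℝ) - 1)) =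
      n ^ (k + 2 - 1) / (((k + 2 : ℕ) : ℝ) - 1) := by
    rw [← mul_div_assoc, ← pow_succ']
    rfl
  rw [KAdj_const_eq_mul, Matrix.charpoly_mul_comm_of_le, mul_partIncidence,
    Matrix.charpoly_sub_scalar, Matrix.charpoly_vecMulVec, hc, mul_assoc]
  · have hsplit : (n : ℝ) ^ (k + 2 - 1) =
        (k + 2 : ℕ) * (n ^ (k + 2 - 1) / (((k + 2 : ℕ) : ℝ) - 1)) -
        n ^ (k + 2 - 1) / (((k + 2 : ℕ) : ℝ) - 1) := by
      field_simp
    congr 1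
    · simp [mul_comm]
    · generalize (n : ℝ) ^ (k + 2 - 1) / (((k + 2 : ℕ) : ℝ) - 1) = a at hsplit ⊢
      rw [hsplit]
      simp [dotProduct, smul_eq_C_mul]
      ring
  · simpa using Nat.le_mul_of_pos_right (k + 2) hn
end

section
/- Let l_1, l_2 ≥ 1 with l_1 + l_2 = m, and let H be the complete m-uniform m-partite hypergraph with l_1 parts of size n_1 and l_2 parts of size n_2. Set s_1 = n_1^{l_1−1} n_2^{l_2} and s_2 = n_1^{l_1} n_2^{l_2−1}. Then the nonzero eigenvalues of the adjacency matrix of H are −s_1/(m−1) with multiplicity l_1−1, −s_2/(m−1) with multiplicity l_2−1, and a^+/(m−1) and a^−/(m−1) each with multiplicity 1, where a^± = (1/2)·[ s_1(l_1−1) + s_2(l_2−1) ± √( (s_1(l_1−1) + s_2(l_2−1))^2 + 4 s_1 s_2 (l_1+l_2−1) ) ]; the eigenvalue 0 has multiplicity l_1 n_1 + l_2 n_2 − m. -/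
open scoped BigOperators
open Polynomial

/-- The transversals of the parts `V_p` that pass through `i` and `j`, as choice functions. -/
def transversalsThrough {m : ℕ} {nn : Fin m → ℕ} (i j : Σ p : Fin m, Fin (nn p)) :
    Finset (∀ p : Fin m, Fin (nn p)) :=
  Fintype.piFinset fun r => Finset.univ.filter fun x =>
    (r = i.1 → (⟨r, x⟩ : Σ p : Fin m, Fin (nn p)) = i) ∧
    (r = j.1 → (⟨r, x⟩ : Σ p : Fin m, Fin (nn p)) = j)

theorem mem_transversalsThrough {m : ℕ} {nn : Fin m → ℕ} (i j : Σ p : Fin m, Fin (nn p))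
    (g : ∀ p : Fin m, Fin (nn p)) :
    g ∈ transversalsThrough i j ↔ g i.1 = i.2 ∧ g j.1 = j.2 := by
  obtain ⟨p, a⟩ := i
  obtain ⟨q, b⟩ := j
  simp only [transversalsThrough, Fintype.mem_piFinset, Finset.mem_filter, Finset.mem_univ,
    true_and]
  constructor
  · intro h
    exact ⟨by simpa using (h p).1 rfl, by simpa using (h q).2 rfl⟩
  · rintro ⟨rfl, rfl⟩ r
    exact ⟨by rintro rfl; rfl, by rintro rfl; rfl⟩

theorem mem_KEdges_iff {m : ℕ} {nn : Fin m → ℕ} (f : Finset (Σ p : Fin m, Fin (nn p))) :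
    f ∈ KEdges m nn ↔
      ∃ g : ∀ p : Fin m, Fin (nn p), Finset.univ.image (fun r => ⟨r, g r⟩) = f := by
  simp only [KEdges, Finset.mem_filter, Finset.mem_univ, true_and]
  constructor
  · rintro ⟨-, h⟩
    have key : ∀ p, ∃ a : Fin (nn p), ∀ x : Fin (nn p),
        (⟨p, x⟩ : Σ p : Fin m, Fin (nn p)) ∈ f ↔ x = a := by
      intro p
      obtain ⟨⟨q, a⟩, hy⟩ := Finset.card_eq_one.1 (h p)
      have hq := (Finset.mem_filter.1 (hy ▸ Finset.mem_singleton_self _ :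
        (⟨q, a⟩ : Σ p : Fin m, Fin (nn p)) ∈ f.filter (fun x => x.1 = p))).2
      obtain rfl : q = p := hq
      refine ⟨a, fun x => ?_⟩
      have := Finset.ext_iff.1 hy ⟨q, x⟩
      simpa using this
    choose g hg using key
    refine ⟨g, ?_⟩
    ext ⟨p, x⟩
    rw [hg]
    simp only [Finset.mem_image, Finset.mem_univ, true_and]
    constructor
    · rintro ⟨r, hr⟩
      cases hr
      rfl
    · rintro rfl
      exact ⟨p, rfl⟩
  · rintro ⟨g, rfl⟩
    constructor
    · rw [Finset.card_image_of_injective _ (fun a b h => congrArg Sigma.fst h)]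
      simp
    · intro p
      rw [Finset.card_eq_one]
      refine ⟨⟨p, g p⟩, ?_⟩
      ext x
      simp only [Finset.mem_filter, Finset.mem_image, Finset.mem_univ, true_and,
        Finset.mem_singleton]
      constructor
      · rintro ⟨⟨r, rfl⟩, rfl⟩
        rfl
      · rintro rfl
        exact ⟨⟨p, rfl⟩, rfl⟩

theorem mem_image_mk_iff {m : ℕ} {nn : Fin m → ℕ} (g : ∀ p : Fin m, Fin (nn p))
    (i : Σ p : Fin m, Fin (nn p)) :
    i ∈ Finset.univ.image (fun r => (⟨r, g r⟩ : Σ p : Fin m, Fin (nn p))) ↔ g i.1 = i.2 := by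
  obtain ⟨p, x⟩ := i
  simp only [Finset.mem_image, Finset.mem_univ, true_and]
  constructor
  · rintro ⟨r, hr⟩
    cases hr
    rfl
  · rintro rfl
    exact ⟨p, rfl⟩

theorem card_edges_through {m : ℕ} {nn : Fin m → ℕ} (i j : Σ p : Fin m, Fin (nn p)) :
    ((KEdges m nn).filter (fun f => i ∈ f ∧ j ∈ f)).card = (transversalsThrough i j).card := by
  symm
  refine Finset.card_nbij
    (fun g => Finset.univ.image (fun r => (⟨r, g r⟩ : Σ p : Fin m, Fin (nn p)))) ?_ ?_ ?_
  · intro g hg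
    rw [Finset.mem_coe, mem_transversalsThrough] at hg
    simp only [Finset.coe_filter, Set.mem_ofPred_eq, mem_image_mk_iff]
    exact ⟨(mem_KEdges_iff _).2 ⟨g, rfl⟩, hg⟩
  · intro g _ g' _ h
    funext p
    have hp := (mem_image_mk_iff g ⟨p, g p⟩).2 rfl
    rw [show Finset.univ.image _ = Finset.univ.image _ from h, mem_image_mk_iff] at hp
    exact hp.symm
  · intro f hf
    simp only [Finset.coe_filter, Set.mem_ofPred_eq] at hf
    obtain ⟨hf, hij⟩ := hf
    obtain ⟨g, rfl⟩ := (mem_KEdges_iff f).1 hf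
    simp only [mem_image_mk_iff] at hij
    exact ⟨g, (mem_transversalsThrough i j g).2 hij, rfl⟩

theorem card_transversalsThrough_of_fst_eq {m : ℕ} {nn : Fin m → ℕ}
    {i j : Σ p : Fin m, Fin (nn p)} (hij : i ≠ j) (h : i.1 = j.1) :
    (transversalsThrough i j).card = 0 := by
  rw [Finset.card_eq_zero, Finset.eq_empty_iff_forall_notMem]
  intro g hg
  rw [mem_transversalsThrough] at hg
  obtain ⟨p, a⟩ := i
  obtain ⟨q, b⟩ := j
  obtain rfl : p = q := h
  exact hij (congrArg (Sigma.mk p) (hg.1.symm.trans hg.2))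

theorem card_transversalsThrough_mul {m : ℕ} {nn : Fin m → ℕ}
    {i j : Σ p : Fin m, Fin (nn p)} (h : i.1 ≠ j.1) :
    (transversalsThrough i j).card * (nn i.1 * nn j.1) = ∏ r, nn r := by
  obtain ⟨p, a⟩ := i
  obtain ⟨q, b⟩ := j
  change p ≠ q at h
  change _ * (nn p * nn q) = _
  have hp : nn p = ∏ r, if r = p then nn r else 1 := by simp
  have hq : nn q = ∏ r, if r = q then nn r else 1 := by simp
  rw [transversalsThrough, Fintype.card_piFinset]
  rw [hp, hq, ← Finset.prod_mul_distrib, ← Finset.prod_mul_distrib]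
  refine Finset.prod_congr rfl fun r _ => ?_
  by_cases hrp : r = p
  · subst hrp
    simp [h, Finset.filter_eq']
  · by_cases hrq : r = q
    · subst hrq
      simp [hrp, Finset.filter_eq']
    · simp [hrp, hrq]

theorem KAdj_apply {m : ℕ} {nn : Fin m → ℕ} (hnn : ∀ p, 1 ≤ nn p)
    (i j : Σ p : Fin m, Fin (nn p)) :
    KAdj m nn i j = if i.1 = j.1 then 0 else
      (∏ r, (nn r : ℝ)) / nn i.1 / ((m : ℝ) - 1) / nn j.1 := by
  have hne : ∀ p, (nn p : ℝ) ≠ 0 := fun p => Nat.cast_ne_zero.2 (by have := hnn p; omega)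
  rw [KAdj]
  by_cases hij : i = j
  · simp [hij]
  · rw [if_neg hij, card_edges_through]
    by_cases h : i.1 = j.1
    · simp [h, card_transversalsThrough_of_fst_eq hij h]
    · rw [if_neg h, ← Nat.cast_prod, ← card_transversalsThrough_mul h]
      have := hne i.1
      have := hne j.1
      push_cast
      field_simp

/-- The quotient matrix of `KAdj` with respect to the partition into parts. -/
noncomputable def partQuotient {m : ℕ} (t : Fin m → ℝ) : Matrix (Fin m) (Fin m) ℝ :=
  Matrix.of fun p q => if p = q then 0 else t p

theorem charpoly_KAdj {m : ℕ} {nn : Fin m → ℕ} (hnn : ∀ p, 1 ≤ nn p) :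
    (KAdj m nn).charpoly = X ^ ((∑ p, nn p) - m) *
      (partQuotient fun p => (∏ r, (nn r : ℝ)) / nn p / ((m : ℝ) - 1)).charpoly := by
  have hne : ∀ p, (nn p : ℝ) ≠ 0 := fun p => Nat.cast_ne_zero.2 (by have := hnn p; omega)
  let U : Matrix (Σ p : Fin m, Fin (nn p)) (Fin m) ℝ := Matrix.of fun i p => if i.1 = p then 1 else 0
  let W : Matrix (Fin m) (Σ p : Fin m, Fin (nn p)) ℝ := Matrix.of fun p j =>
    if p = j.1 then 0 else (∏ r, (nn r : ℝ)) / nn p / ((m : ℝ) - 1) / nn j.1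
  have hUW : KAdj m nn = U * W := by
    ext i j
    simp only [KAdj_apply hnn, Matrix.mul_apply, Matrix.of_apply, U, W, ite_mul, one_mul, zero_mul,
      Finset.sum_ite_eq, Finset.mem_univ, if_true]
  have hWU : (partQuotient fun p => (∏ r, (nn r : ℝ)) / nn p / ((m : ℝ) - 1)) = W * U := by
    ext p q
    have := hne q
    simp only [partQuotient, Matrix.mul_apply, Matrix.of_apply, U, W, Fintype.sum_sigma, mul_ite, mul_one,
      mul_zero, Finset.sum_const, Finset.card_univ, Fintype.card_fin, nsmul_eq_mul,
      Finset.sum_ite_eq', Finset.mem_univ, if_true]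
    split_ifs
    · simp
    · field_simp
  have hle : Fintype.card (Fin m) ≤ Fintype.card (Σ p : Fin m, Fin (nn p)) := by
    simpa using Finset.sum_le_sum fun p (_ : p ∈ Finset.univ) => hnn p
  rw [hUW, hWU, Matrix.charpoly_mul_comm_of_le _ _ hle]
  simp

theorem charpoly_partQuotient {m : ℕ} (t : Fin m → ℝ) :
    algebraMap ℝ[X] (RatFunc ℝ) (partQuotient t).charpoly =
      (∏ p, algebraMap ℝ[X] (RatFunc ℝ) (X + C (t p))) *
        (1 - ∑ p, algebraMap ℝ[X] (RatFunc ℝ) (C (t p)) /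
          algebraMap ℝ[X] (RatFunc ℝ) (X + C (t p))) := by
  have hne : ∀ p, algebraMap ℝ[X] (RatFunc ℝ) (X + C (t p)) ≠ 0 := fun p =>
    (map_ne_zero_iff _ (RatFunc.algebraMap_injective ℝ)).2 (X_add_C_ne_zero _)
  set d : Fin m → RatFunc ℝ := fun p => algebraMap ℝ[X] (RatFunc ℝ) (X + C (t p)) with hd
  have hfac : (algebraMap ℝ[X] (RatFunc ℝ)).mapMatrix (Matrix.charmatrix (partQuotient t)) =
      Matrix.diagonal d * (1 + Matrix.replicateCol Unit
        (fun p => -(algebraMap ℝ[X] (RatFunc ℝ) (C (t p)) / d p)) *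
        Matrix.replicateRow Unit (1 : Fin m → RatFunc ℝ)) := by
    ext p q
    have hp : d p ≠ 0 := hne p
    have hentry : (Matrix.replicateCol Unit
        (fun p => -(algebraMap ℝ[X] (RatFunc ℝ) (C (t p)) / d p)) *
        Matrix.replicateRow Unit (1 : Fin m → RatFunc ℝ)) p q =
        -(algebraMap ℝ[X] (RatFunc ℝ) (C (t p)) / d p) := by
      simp [Matrix.mul_apply]
    rw [Matrix.diagonal_mul, Matrix.add_apply, hentry, RingHom.mapMatrix_apply, Matrix.map_apply]
    by_cases hpq : p = q
    · subst hpq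
      rw [Matrix.charmatrix_apply_eq, Matrix.one_apply_eq, mul_add, mul_neg, mul_div_cancel₀ _ hp]
      simp [partQuotient, hd]
    · rw [Matrix.charmatrix_apply_ne _ _ _ hpq, Matrix.one_apply_ne hpq, zero_add, mul_neg,
        mul_div_cancel₀ _ hp]
      simp [partQuotient, hpq]
  rw [Matrix.charpoly, RingHom.map_det, hfac, Matrix.det_mul, Matrix.det_diagonal,
    Matrix.det_one_add_replicateCol_mul_replicateRow]
  simp only [dotProduct, Pi.one_apply, one_mul, Finset.sum_neg_distrib, sub_eq_add_neg, hd]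

theorem card_filter_val_lt {l₁ l₂ m : ℕ} (hm : l₁ + l₂ = m) :
    (Finset.univ.filter fun p : Fin m => (p : ℕ) < l₁).card = l₁ ∧
      (Finset.univ.filter fun p : Fin m => ¬ (p : ℕ) < l₁).card = l₂ := by
  have h₁ : (Finset.univ.filter fun p : Fin m => (p : ℕ) < l₁).card = l₁ := by
    rw [Fin.card_filter_val_lt]
    omega
  have h₂ := Finset.card_filter_add_card_filter_not (s := (Finset.univ : Finset (Fin m)))
    (fun p => (p : ℕ) < l₁)
  rw [Finset.card_univ, Fintype.card_fin] at h₂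
  exact ⟨h₁, by omega⟩

theorem charpoly_partQuotient_ite {m l₁ l₂ : ℕ} (hl₁ : 1 ≤ l₁) (hl₂ : 1 ≤ l₂)
    (hm : l₁ + l₂ = m) (t₁ t₂ : ℝ) :
    (partQuotient fun p : Fin m => if (p : ℕ) < l₁ then t₁ else t₂).charpoly =
      (X + C t₁) ^ (l₁ - 1) * (X + C t₂) ^ (l₂ - 1) *
        ((X + C t₁) * (X + C t₂) - (l₁ : ℝ[X]) * C t₁ * (X + C t₂) -
          (l₂ : ℝ[X]) * C t₂ * (X + C t₁)) := by
  obtain ⟨k₁, rfl⟩ := Nat.exists_eq_add_of_le' hl₁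
  obtain ⟨k₂, rfl⟩ := Nat.exists_eq_add_of_le' hl₂
  obtain ⟨hc₁, hc₂⟩ := card_filter_val_lt hm
  have hne : ∀ t : ℝ, algebraMap ℝ[X] (RatFunc ℝ) (X + C t) ≠ 0 := fun t =>
    (map_ne_zero_iff _ (RatFunc.algebraMap_injective ℝ)).2 (X_add_C_ne_zero _)
  apply RatFunc.algebraMap_injective ℝ
  rw [charpoly_partQuotient]
  have h₁ := hne t₁
  have h₂ := hne t₂
  have hprod : ∏ p : Fin m, algebraMap ℝ[X] (RatFunc ℝ)
      (X + C (if (p : ℕ) < k₁ + 1 then t₁ else t₂)) =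
      algebraMap ℝ[X] (RatFunc ℝ) (X + C t₁) ^ (k₁ + 1) *
        algebraMap ℝ[X] (RatFunc ℝ) (X + C t₂) ^ (k₂ + 1) := by
    rw [← Finset.prod_filter_mul_prod_filter_not Finset.univ (fun p : Fin m => (p : ℕ) < k₁ + 1),
      Finset.prod_congr rfl (fun p hp => by rw [if_pos (Finset.mem_filter.1 hp).2]),
      Finset.prod_congr (s₁ := Finset.univ.filter fun p : Fin m => ¬ (p : ℕ) < k₁ + 1) rfl
        (fun p hp => by rw [if_neg (Finset.mem_filter.1 hp).2]),
      Finset.prod_const, Finset.prod_const, hc₁, hc₂]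
  have hsum : ∑ p : Fin m, algebraMap ℝ[X] (RatFunc ℝ) (C (if (p : ℕ) < k₁ + 1 then t₁ else t₂)) /
      algebraMap ℝ[X] (RatFunc ℝ) (X + C (if (p : ℕ) < k₁ + 1 then t₁ else t₂)) =
      (k₁ + 1 : ℕ) * (algebraMap ℝ[X] (RatFunc ℝ) (C t₁) /
        algebraMap ℝ[X] (RatFunc ℝ) (X + C t₁)) +
      (k₂ + 1 : ℕ) * (algebraMap ℝ[X] (RatFunc ℝ) (C t₂) /
        algebraMap ℝ[X] (RatFunc ℝ) (X + C t₂)) := by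
    rw [← Finset.sum_filter_add_sum_filter_not Finset.univ (fun p : Fin m => (p : ℕ) < k₁ + 1),
      Finset.sum_congr rfl (fun p hp => by rw [if_pos (Finset.mem_filter.1 hp).2]),
      Finset.sum_congr (s₁ := Finset.univ.filter fun p : Fin m => ¬ (p : ℕ) < k₁ + 1) rfl
        (fun p hp => by rw [if_neg (Finset.mem_filter.1 hp).2]),
      Finset.sum_const, Finset.sum_const, hc₁, hc₂, nsmul_eq_mul, nsmul_eq_mul]
  rw [hprod, hsum]
  simp only [map_mul, map_sub, map_pow, map_natCast, add_tsub_cancel_right]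
  field_simp
  ring

/-- the spectrum of the complete `m`-uniform `m`-partite hypergraph with
`l₁` parts of size `n₁` and `l₂` parts of size `n₂` (`l₁ + l₂ = m`): eigenvalue `0`
with multiplicity `l₁n₁ + l₂n₂ - m`, `-s₁/(m-1)` with multiplicity `l₁ - 1`,
`-s₂/(m-1)` with multiplicity `l₂ - 1`, and `a⁺/(m-1)`, `a⁻/(m-1)` each once,
where `s₁ = n₁^(l₁-1) n₂^l₂`, `s₂ = n₁^l₁ n₂^(l₂-1)` and
`a^± = (s₁(l₁-1) + s₂(l₂-1) ± √((s₁(l₁-1)+s₂(l₂-1))² + 4s₁s₂(l₁+l₂-1)))/2`. -/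
theorem stmt_7 (m l₁ l₂ n₁ n₂ : ℕ) (hl₁ : 1 ≤ l₁) (hl₂ : 1 ≤ l₂) (hm : l₁ + l₂ = m)
    (hn₁ : 1 ≤ n₁) (hn₂ : 1 ≤ n₂) :
    ∀ s₁ s₂ aplus aminus : ℝ,
      s₁ = (n₁ : ℝ) ^ (l₁ - 1) * (n₂ : ℝ) ^ l₂ →
      s₂ = (n₁ : ℝ) ^ l₁ * (n₂ : ℝ) ^ (l₂ - 1) →
      aplus = (1 / 2) * (s₁ * ((l₁ : ℝ) - 1) + s₂ * ((l₂ : ℝ) - 1) +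
        Real.sqrt ((s₁ * ((l₁ : ℝ) - 1) + s₂ * ((l₂ : ℝ) - 1)) ^ 2 +
          4 * s₁ * s₂ * ((l₁ : ℝ) + (l₂ : ℝ) - 1))) →
      aminus = (1 / 2) * (s₁ * ((l₁ : ℝ) - 1) + s₂ * ((l₂ : ℝ) - 1) -
        Real.sqrt ((s₁ * ((l₁ : ℝ) - 1) + s₂ * ((l₂ : ℝ) - 1)) ^ 2 +
          4 * s₁ * s₂ * ((l₁ : ℝ) + (l₂ : ℝ) - 1))) →
      (KAdj m (fun p => if (p : ℕ) < l₁ then n₁ else n₂)).charpoly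
        = X ^ (l₁ * n₁ + l₂ * n₂ - m) *
            (X + C (s₁ / ((m : ℝ) - 1))) ^ (l₁ - 1) *
            (X + C (s₂ / ((m : ℝ) - 1))) ^ (l₂ - 1) *
            (X - C (aplus / ((m : ℝ) - 1))) *
            (X - C (aminus / ((m : ℝ) - 1))) := by
  rintro s₁ s₂ aplus aminus hs₁ hs₂ rfl rfl
  have hn₁' : (n₁ : ℝ) ≠ 0 := Nat.cast_ne_zero.2 (by omega)
  have hn₂' : (n₂ : ℝ) ≠ 0 := Nat.cast_ne_zero.2 (by omega)
  obtain ⟨hc₁, hc₂⟩ := card_filter_val_lt hm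
  have hsum : ∑ p : Fin m, (if (p : ℕ) < l₁ then n₁ else n₂) = l₁ * n₁ + l₂ * n₂ := by
    rw [Finset.sum_ite, Finset.sum_const, Finset.sum_const, hc₁, hc₂, smul_eq_mul, smul_eq_mul]
  have hprod : ∏ p : Fin m, ((if (p : ℕ) < l₁ then n₁ else n₂ : ℕ) : ℝ) =
      (n₁ : ℝ) ^ l₁ * (n₂ : ℝ) ^ l₂ := by
    simp only [Nat.cast_ite]
    rw [Finset.prod_ite, Finset.prod_const, Finset.prod_const, hc₁, hc₂]
  have ht : (fun p : Fin m => (n₁ : ℝ) ^ l₁ * (n₂ : ℝ) ^ l₂ /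
        ((if (p : ℕ) < l₁ then n₁ else n₂ : ℕ) : ℝ) / ((m : ℝ) - 1)) =
      fun p : Fin m => if (p : ℕ) < l₁ then s₁ / ((m : ℝ) - 1) else s₂ / ((m : ℝ) - 1) := by
    funext p
    split_ifs
    · rw [hs₁, ← pow_sub_one_mul (by omega : l₁ ≠ 0)]
      field_simp
    · rw [hs₂, ← pow_sub_one_mul (by omega : l₂ ≠ 0) (n₂ : ℝ)]
      field_simp
  have hs₁0 : 0 ≤ s₁ := by rw [hs₁]; positivity
  have hs₂0 : 0 ≤ s₂ := by rw [hs₂]; positivity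
  have hl₁' : (1 : ℝ) ≤ l₁ := by exact_mod_cast hl₁
  have hl₂' : (1 : ℝ) ≤ l₂ := by exact_mod_cast hl₂
  have hdisc : 0 ≤ (s₁ * ((l₁ : ℝ) - 1) + s₂ * ((l₂ : ℝ) - 1)) ^ 2 +
      4 * s₁ * s₂ * ((l₁ : ℝ) + (l₂ : ℝ) - 1) := by
    have : 0 ≤ (l₁ : ℝ) + l₂ - 1 := by linarith
    positivity
  have hsq := Real.sq_sqrt hdisc
  set r := Real.sqrt ((s₁ * ((l₁ : ℝ) - 1) + s₂ * ((l₂ : ℝ) - 1)) ^ 2 +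
      4 * s₁ * s₂ * ((l₁ : ℝ) + (l₂ : ℝ) - 1))
  rw [charpoly_KAdj (fun p => by split_ifs <;> assumption), hsum, hprod, ht,
    charpoly_partQuotient_ite hl₁ hl₂ hm]
  have hquad : (X + C (s₁ / ((m : ℝ) - 1))) * (X + C (s₂ / ((m : ℝ) - 1))) -
        (l₁ : ℝ[X]) * C (s₁ / ((m : ℝ) - 1)) * (X + C (s₂ / ((m : ℝ) - 1))) -
        (l₂ : ℝ[X]) * C (s₂ / ((m : ℝ) - 1)) * (X + C (s₁ / ((m : ℝ) - 1))) =
      (X - C (1 / 2 * (s₁ * ((l₁ : ℝ) - 1) + s₂ * ((l₂ : ℝ) - 1) + r) / ((m : ℝ) - 1))) *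
        (X - C (1 / 2 * (s₁ * ((l₁ : ℝ) - 1) + s₂ * ((l₂ : ℝ) - 1) - r) / ((m : ℝ) - 1))) := by
    refine Polynomial.funext fun x => ?_
    simp only [eval_mul, eval_sub, eval_add, eval_X, eval_C, eval_natCast, div_eq_mul_inv]
    linear_combination (1 / 4) * ((m : ℝ) - 1)⁻¹ ^ 2 * hsq
  rw [hquad]
  ring
end
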